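/- arXiv:2106.02880 — 4 statements merged into one kernel-verified Lean document; each statement's English description precedes it below -/
import Mathlib

section
/- Let f : [0,∞) → ℝ be a continuously differentiable convex function and let S be a convex subset of [0,∞) × ℝ such that, for some x₀ > 0: (x,y) ∈ S for all 0 < x < x₀ and y > f(x), and (x,y) ∉ S for all 0 < x < x₀ and y < f(x). Then S ⊆ {(x,y) : y ≥ T_{x₀}(x)}, where T_{x₀}(x) = f(x₀) + f′(x₀)(x − x₀) is the tangent line to f at x₀. -/
open Set

/-- A convex function lies above each of its tangents. -/
theorem ConvexOn.tangent_le {f : ℝ → ℝ} {s : Set ℝ} {x z m : ℝ} (hf : ConvexOn ℝ s f)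
    (hx : x ∈ s) (hz : z ∈ s) (hm : HasDerivWithinAt f m s x) : f x + m * (z - x) ≤ f z := by
  rcases lt_trichotomy x z with h | rfl | h
  · have hs := hf.le_slope_of_hasDerivWithinAt hx hz h hm
    rw [slope_def_field, le_div_iff₀ (sub_pos.2 h)] at hs
    linarith
  · simp
  · have hs := hf.slope_le_of_hasDerivWithinAt hz hx h hm
    rw [slope_def_field, div_le_iff₀ (sub_pos.2 h)] at hs
    linarith

/-- **Lemma.**  Let `f : [0,∞) → ℝ` be a continuously differentiable convex function and `S` a
convex subset of `[0,∞) × ℝ` such that, for some `x₀ > 0`, `(x,y) ∈ S` whenever `0 < x < x₀`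
and `y > f(x)`, and `(x,y) ∉ S` whenever `0 < x < x₀` and `y < f(x)`.  Then `S` is contained in
`{(x,y) : y ≥ T_{x₀}(x)}`, where `T_{x₀}(x) = f(x₀) + f′(x₀)(x − x₀)` is the tangent to `f`
at `x₀`. -/
theorem tangent_lemma (f f' : ℝ → ℝ)
    (hconv : ConvexOn ℝ (Ici 0) f)
    (hderiv : ∀ x ∈ Ici (0 : ℝ), HasDerivWithinAt f (f' x) (Ici 0) x)
    (hcont : ContinuousOn f' (Ici 0))
    (S : Set (ℝ × ℝ)) (hS : Convex ℝ S) (hSsub : ∀ p ∈ S, 0 ≤ p.1)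
    (x₀ : ℝ) (hx₀ : 0 < x₀)
    (hin : ∀ x y : ℝ, 0 < x → x < x₀ → f x < y → (x, y) ∈ S)
    (hout : ∀ x y : ℝ, 0 < x → x < x₀ → y < f x → (x, y) ∉ S) :
    ∀ p ∈ S, f x₀ + f' x₀ * (p.1 - x₀) ≤ p.2 := by
  rintro ⟨a, b⟩ hp
  have hcontf : ContinuousOn f (Ici 0) := fun x hx => (hderiv x hx).continuousWithinAt
  have tangent_le_of_lt : ∀ x ∈ Ioo 0 x₀, f x + f' x * (a - x) ≤ b := by
    rintro x ⟨hx0, hx⟩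
    have htend : Filter.Tendsto (fun t : ℝ => x + t * (a - x)) (nhdsWithin 0 (Ioi 0)) (nhds x) := by
      have hc : Continuous fun t : ℝ => x + t * (a - x) := by fun_prop
      simpa using (hc.tendsto 0).mono_left nhdsWithin_le_nhds
    obtain ⟨t, ⟨hz0, hz⟩, ht0, ht1⟩ := ((htend.eventually (Ioo_mem_nhds hx0 hx)).and
      (Ioo_mem_nhdsGT (zero_lt_one (α := ℝ)))).exists
    have hchord : f (x + t * (a - x)) ≤ (1 - t) * f x + t * b := by
      by_contra! hlt
      have h1t : 0 < 1 - t := sub_pos.2 ht1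
      obtain ⟨y, hy, hy'⟩ : ∃ y, f x < y ∧ y < (f (x + t * (a - x)) - t * b) / (1 - t) :=
        exists_between (by rw [lt_div_iff₀ h1t]; linarith)
      rw [lt_div_iff₀ h1t] at hy'
      refine hout (x + t * (a - x)) ((1 - t) * y + t * b) hz0 hz (by linarith) ?_
      have hmem := hS (hin x y hx0 hx hy) hp h1t.le ht0.le (by ring)
      convert hmem using 1
      ext
      · simp only [Prod.smul_mk, Prod.mk_add_mk, smul_eq_mul]
        ring
      · simp
    have htan := hconv.tangent_le hx0.le hz0.le (hderiv x hx0.le)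
    exact le_of_mul_le_mul_left (by linarith) ht0
  have hT : ContinuousAt (fun x => f x + f' x * (a - x)) x₀ :=
    (hcontf.continuousAt (Ici_mem_nhds hx₀)).add
      ((hcont.continuousAt (Ici_mem_nhds hx₀)).mul (by fun_prop))
  exact le_of_tendsto (hT.tendsto.mono_left nhdsWithin_le_nhds)
    (Filter.mem_of_superset (Ioo_mem_nhdsLT hx₀) tangent_le_of_lt)
end

section
/- Let {λ_{i,n} : 1 ≤ i ≤ m_n, n ≥ 1} be a triangular array of nonnegative reals with ∑_{i=1}^{m_n} λ_{i,n} = 1 for every n and max_{1≤i≤m_n} λ_{i,n} → 0 as n → ∞. Then for every fixed k ≥ 2 and all nonnegative reals y₂,…,y_k, the quantity ∑_{(j₁,…,j_k) ∈ S(k,m_n)} (∏_{i=1}^k λ_{j_i,n}) · exp(∑_{r=2}^k (∑_{i=1}^{r−1} λ_{j_i,n}) y_r) converges to 1 as n → ∞. -/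
open Filter
open scoped Topology

/-- The weights of all `k`-tuples sum to `1`, so those of the distinct ones sum to at most `1`. -/
lemma sum_injective_prod_le_one {α : Type*} [Fintype α] [DecidableEq α] (w : α → ℝ)
    (hw : ∀ a, 0 ≤ w a) (hsum : ∑ a, w a = 1) (k : ℕ) :
    ∑ j ∈ Finset.univ.filter (fun j : Fin k → α => Function.Injective j), ∏ i, w (j i) ≤ 1 := by
  calc
    _ ≤ ∑ j : Fin k → α, ∏ i, w (j i) :=
      Finset.sum_le_sum_of_subset_of_nonneg (Finset.filter_subset _ _)
        fun j _ _ => Finset.prod_nonneg fun i _ => hw _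
    _ = 1 := by rw [← Fintype.sum_pow, hsum, one_pow]

lemma one_sub_le_sum_notMem_range {α : Type*} [Fintype α] [DecidableEq α] (w : α → ℝ)
    (hsum : ∑ a, w a = 1) {ε : ℝ} (hε : ∀ a, w a ≤ ε) {k : ℕ} {j : Fin k → α}
    (hj : Function.Injective j) :
    1 - k * ε ≤ ∑ a ∈ Finset.univ.filter (fun a => a ∉ Set.range j), w a := by
  have hsplit := Finset.sum_filter_add_sum_filter_not Finset.univ (fun a => a ∈ Set.range j) w
  have himage : Finset.univ.filter (fun a => a ∈ Set.range j) = Finset.univ.image j := by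
    ext a; simp
  have hle : ∑ i, w (j i) ≤ k * ε := by
    simpa using Finset.sum_le_sum fun i (_ : i ∈ Finset.univ) => hε (j i)
  rw [himage, Finset.sum_image hj.injOn, hsum] at hsplit
  linarith

lemma one_sub_le_sum_injective_prod {α : Type*} [Fintype α] [DecidableEq α] (w : α → ℝ)
    (hw : ∀ a, 0 ≤ w a) (hsum : ∑ a, w a = 1) {ε : ℝ} (hε0 : 0 ≤ ε) (hε : ∀ a, w a ≤ ε)
    (k : ℕ) :
    1 - (k : ℝ) ^ 2 * ε ≤
      ∑ j ∈ Finset.univ.filter (fun j : Fin k → α => Function.Injective j), ∏ i, w (j i) := by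
  induction k with
  | zero => simp [Function.injective_of_subsingleton]
  | succ k ih =>
    have hstep :
        ∑ j ∈ Finset.univ.filter (fun j : Fin (k + 1) → α => Function.Injective j),
            ∏ i, w (j i) =
          ∑ j ∈ Finset.univ.filter (fun j : Fin k → α => Function.Injective j),
            (∏ i, w (j i)) * ∑ a ∈ Finset.univ.filter (fun a => a ∉ Set.range j), w a := by
      rw [Finset.sum_filter, ← (Fin.consEquiv fun _ => α).sum_comp, Fintype.sum_prod_type_right,
        Finset.sum_filter]
      refine Finset.sum_congr rfl fun j _ => ?_
      have hcons : ∀ a, Function.Injective ((Fin.consEquiv fun _ => α) (a, j)) ↔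
          a ∉ Set.range j ∧ Function.Injective j := fun a => Fin.cons_injective_iff
      by_cases hj : Function.Injective j
      · simp only [hcons, Fin.consEquiv_apply, hj, and_true, if_true,
          Fin.prod_univ_succ, Fin.cons_zero, Fin.cons_succ]
        rw [← Finset.sum_filter, Finset.mul_sum]
        exact Finset.sum_congr rfl fun a _ => mul_comm _ _
      · simp [hcons, hj]
    rw [hstep]
    have hlower :
        (∑ j ∈ Finset.univ.filter (fun j : Fin k → α => Function.Injective j),
            ∏ i, w (j i)) * (1 - k * ε) ≤
          ∑ j ∈ Finset.univ.filter (fun j : Fin k → α => Function.Injective j),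
            (∏ i, w (j i)) * ∑ a ∈ Finset.univ.filter (fun a => a ∉ Set.range j), w a := by
      rw [Finset.sum_mul]
      refine Finset.sum_le_sum fun j hj => ?_
      exact mul_le_mul_of_nonneg_left
        (one_sub_le_sum_notMem_range w hsum hε (Finset.mem_filter.1 hj).2)
        (Finset.prod_nonneg fun i _ => hw _)
    have hkε : 0 ≤ (k : ℝ) * ε := by positivity
    have hupper := mul_le_mul_of_nonneg_left (sum_injective_prod_le_one w hw hsum k) hkε
    push_cast
    nlinarith

/-- **Lemma.**  Let `{λ_{i,n} : 1 ≤ i ≤ m_n}` be a triangular array of nonnegative reals with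
`∑_i λ_{i,n} = 1` for every `n` and `max_i λ_{i,n} → 0`.  Then for every fixed `k ≥ 2` and all
nonnegative reals `y₂, …, y_k`,
`∑_{(j₁,…,j_k) distinct} (∏_{i=1}^k λ_{j_i,n}) · exp(∑_{r=2}^k (∑_{i=1}^{r-1} λ_{j_i,n}) y_r)`
converges to `1`.  (Indices are `0`-based: the tuple entry `j i` corresponds to `j_{i+1}`, and
`y r` for `r ≥ 1` corresponds to `y_{r+1}`; the term `r = 0` vanishes since the inner sum over
`i < 0` is empty.) -/
theorem sum_products_distinct_tuples_exp (m : ℕ → ℕ) (lam : (n : ℕ) → Fin (m n) → ℝ)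
    (hnn : ∀ n i, 0 ≤ lam n i)
    (hsum : ∀ n, ∑ i, lam n i = 1)
    (hmax : ∀ ε > (0 : ℝ), ∀ᶠ n in atTop, ∀ i, lam n i < ε)
    (k : ℕ) (hk : 2 ≤ k) (y : Fin k → ℝ) (hy : ∀ r, 0 ≤ y r) :
    Tendsto
      (fun n => ∑ j ∈ Finset.univ.filter (fun j : Fin k → Fin (m n) => Function.Injective j),
        (∏ i : Fin k, lam n (j i)) *
          Real.exp (∑ r : Fin k, (∑ i ∈ Finset.univ.filter (· < r), lam n (j i)) * y r))
      atTop (𝓝 1) := by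
  have hε : Tendsto (fun n => ⨆ i, lam n i) atTop (𝓝 0) := by
    rw [Metric.tendsto_nhds]
    intro ε hε
    filter_upwards [hmax (ε / 2) (half_pos hε)] with n hn
    rw [Real.dist_0_eq_abs, abs_of_nonneg (Real.iSup_nonneg (hnn n))]
    exact (Real.iSup_le (fun i => (hn i).le) (half_pos hε).le).trans_lt (half_lt_self hε)
  have hle : ∀ n i, lam n i ≤ ⨆ i, lam n i := fun n i =>
    le_ciSup (Set.finite_range (lam n)).bddAbove i
  have hε0 : ∀ n, 0 ≤ ⨆ i, lam n i := fun n => Real.iSup_nonneg (hnn n)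
  have hlow : Tendsto (fun n => 1 - (k : ℝ) ^ 2 * ⨆ i, lam n i) atTop (𝓝 1) := by
    simpa using (hε.const_mul ((k : ℝ) ^ 2)).const_sub 1
  have hupp : Tendsto (fun n => Real.exp (∑ r, (k * ⨆ i, lam n i) * y r)) atTop (𝓝 1) := by
    have h := (hε.const_mul (k : ℝ)).mul_const (∑ r, y r)
    simpa [Finset.mul_sum] using h.rexp
  refine tendsto_of_tendsto_of_tendsto_of_le_of_le hlow hupp (fun n => ?_) (fun n => ?_)
  · refine (one_sub_le_sum_injective_prod (lam n) (hnn n) (hsum n) (hε0 n) (hle n) k).trans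
      (Finset.sum_le_sum fun j _ => ?_)
    refine le_mul_of_one_le_right (Finset.prod_nonneg fun i _ => hnn n _) (Real.one_le_exp ?_)
    exact Finset.sum_nonneg fun r _ =>
      mul_nonneg (Finset.sum_nonneg fun i _ => hnn n _) (hy r)
  · have hexp : ∀ j : Fin k → Fin (m n),
        Real.exp (∑ r : Fin k, (∑ i ∈ Finset.univ.filter (· < r), lam n (j i)) * y r) ≤
          Real.exp (∑ r, (k * ⨆ i, lam n i) * y r) := by
      refine fun j => Real.exp_le_exp.2 (Finset.sum_le_sum fun r _ =>
        mul_le_mul_of_nonneg_right ?_ (hy r))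
      calc
        _ ≤ ∑ i, lam n (j i) :=
          Finset.sum_le_sum_of_subset_of_nonneg (Finset.filter_subset _ _)
            fun i _ _ => hnn n _
        _ ≤ k * ⨆ i, lam n i := by
          simpa using Finset.sum_le_sum fun i (_ : i ∈ Finset.univ) => hle n (j i)
    refine (Finset.sum_le_sum fun j _ => mul_le_mul_of_nonneg_left (hexp j)
      (Finset.prod_nonneg fun i _ => hnn n _)).trans ?_
    rw [← Finset.sum_mul]
    exact mul_le_of_le_one_left (Real.exp_pos _).le
      (sum_injective_prod_le_one (lam n) (hnn n) (hsum n) k)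
end

section
/- Let (k_n)_{n≥1} be positive integers and, for each n, let x_{n,1},…,x_{n,k_n} be real numbers. Then the set S = {(c,d) ∈ [0,∞) × ℝ : limsup_{n→∞} ∑_{i=1}^{k_n} exp(c·x_{n,i} − n·d) < ∞} is a convex subset of ℝ². -/
open Filter
open scoped ENNReal

/-- **Lemma.**  For positive integers `(k_n)` and reals `x_{n,1}, …, x_{n,k_n}`, the set
`S = {(c,d) ∈ [0,∞) × ℝ : limsup_n ∑_{i=1}^{k_n} exp(c x_{n,i} − n d) < ∞}` is a convex
subset of `ℝ²` (the `limsup` being taken in the extended reals). -/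
theorem limsup_finite_set_convex (k : ℕ → ℕ) (hk : ∀ n, 0 < k n) (x : ℕ → ℕ → ℝ) :
    Convex ℝ {p : ℝ × ℝ | 0 ≤ p.1 ∧
      Filter.limsup
        (fun n => ENNReal.ofReal
          (∑ i ∈ Finset.range (k n), Real.exp (p.1 * x n i - n * p.2))) atTop < ⊤} := by
  rintro p ⟨hp, hp'⟩ q ⟨hq, hq'⟩ a b ha hb hab
  obtain ⟨M, hpM, hM⟩ := exists_between hp'
  obtain ⟨N, hqN, hN⟩ := exists_between hq'
  refine ⟨?_, lt_of_le_of_lt (limsup_le_of_le (h := ?_)) (ENNReal.add_lt_top.2 ⟨hM, hN⟩)⟩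
  · simp only [Prod.fst_add, Prod.smul_fst, smul_eq_mul]
    positivity
  · filter_upwards [eventually_lt_of_limsup_lt hpM, eventually_lt_of_limsup_lt hqN] with n hn hn'
    refine le_trans ?_ (add_le_add hn.le hn'.le)
    rw [← ENNReal.ofReal_add (by positivity) (by positivity), ← Finset.sum_add_distrib]
    refine ENNReal.ofReal_le_ofReal (Finset.sum_le_sum fun i _ => ?_)
    have h := convexOn_exp.2 (Set.mem_univ (p.1 * x n i - n * p.2))
      (Set.mem_univ (q.1 * x n i - n * q.2)) ha hb hab
    simp only [Prod.fst_add, Prod.snd_add, Prod.smul_fst, Prod.smul_snd, smul_eq_mul] at h ⊢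
    calc _ = Real.exp (a * (p.1 * x n i - n * p.2) + b * (q.1 * x n i - n * q.2)) := by
          congr 1; ring
      _ ≤ _ := h
      _ ≤ _ := add_le_add
          (mul_le_of_le_one_left (Real.exp_pos _).le (by linarith))
          (mul_le_of_le_one_left (Real.exp_pos _).le (by linarith))
end

section
/- Let Z = ∑_{j=1}^N δ_{ξ_j} be a point process on ℝ with N = Z(ℝ) finite a.s., satisfying: (A1) m(θ) := E[∑_{j=1}^N e^{θξ_j}] < ∞ for all θ ∈ (−ϑ,∞) for some ϑ > 0, and (A3) E[N^{1+p}] < ∞ for some p > 0. Then there exists q > 0 such that for all θ ∈ [0,∞), E[(∑_{j=1}^N e^{θξ_j})^{1+q}] < ∞. -/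
open MeasureTheory

/-- A power-mean inequality followed by the bound `√(a * b) ≤ a + b`. -/
theorem rpow_sum_exp_le {p : ℝ} (hp : 0 ≤ p) (n : ℕ) (x : ℕ → ℝ) :
    (∑ j ∈ Finset.range n, Real.exp (x j)) ^ (1 + p / 2) ≤
      (n : ℝ) ^ (1 + p) + ∑ j ∈ Finset.range n, Real.exp ((2 + p) * x j) := by
  have hS : 0 ≤ ∑ j ∈ Finset.range n, Real.exp (x j) := by positivity
  have hn : 0 ≤ (n : ℝ) ^ (1 + p) := by positivity
  have hM : 0 ≤ ∑ j ∈ Finset.range n, Real.exp ((2 + p) * x j) := by positivity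
  have key := Real.rpow_sum_le_const_mul_sum_rpow_of_nonneg (Finset.range n)
    (f := fun j => Real.exp (x j)) (p := 2 + p) (by linarith) fun _ _ => (Real.exp_pos _).le
  simp only [Finset.card_range, ← Real.exp_mul, mul_comm (x _),
    show 2 + p - 1 = 1 + p by ring] at key
  refine (sq_le_sq₀ (by positivity) (by positivity)).mp ?_
  rw [← Real.rpow_mul_natCast hS, show (1 + p / 2) * (2 : ℕ) = 2 + p by push_cast; ring]
  nlinarith [mul_nonneg hn hM]

/-- **Proposition.**  Let `Z = ∑_{j=1}^N δ_{ξ_j}` be a point process on `ℝ` satisfying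
(A1) `m(θ) = E[∑_{j=1}^N e^{θ ξ_j}] < ∞` for all `θ ∈ (−ϑ,∞)` for some `ϑ > 0`, and
(A3) `E[N^{1+p}] < ∞` for some `p > 0`.  Then there exists `q > 0` such that for all
`θ ∈ [0,∞)`, `E[(∑_{j=1}^N e^{θ ξ_j})^{1+q}] < ∞`. -/
theorem moment_bound {Ω : Type*} [MeasurableSpace Ω] (P : Measure Ω) [IsProbabilityMeasure P]
    (N : Ω → ℕ) (ξ : ℕ → Ω → ℝ)
    (hN : Measurable N) (hξ : ∀ j, Measurable (ξ j))
    (ϑ : ℝ) (hϑ : 0 < ϑ)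
    (hA1 : ∀ θ : ℝ, -ϑ < θ →
      Integrable (fun ω => ∑ j ∈ Finset.range (N ω), Real.exp (θ * ξ j ω)) P)
    (p : ℝ) (hp : 0 < p) (hA3 : Integrable (fun ω => (N ω : ℝ) ^ (1 + p)) P) :
    ∃ q > (0 : ℝ), ∀ θ : ℝ, 0 ≤ θ →
      Integrable (fun ω => (∑ j ∈ Finset.range (N ω), Real.exp (θ * ξ j ω)) ^ (1 + q)) P := by
  refine ⟨p / 2, by positivity, fun θ hθ => ?_⟩
  have hM := hA1 ((2 + p) * θ) (by nlinarith [mul_nonneg (by linarith : 0 ≤ 2 + p) hθ])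
  refine (hA3.add hM).mono'
    (((hA1 θ (by linarith)).aemeasurable.pow_const _).aestronglyMeasurable)
    (Filter.Eventually.of_forall fun ω => ?_)
  simp only [Pi.add_apply, mul_assoc]
  rw [Real.norm_of_nonneg (by positivity)]
  exact rpow_sum_exp_le hp.le (N ω) fun j => θ * ξ j ω
end
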